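/- (Lemma 2.1(i)) For every α ∈ [−1,1] and r ∈ [1,λ], the superposition operator Ξ_α^r : L^λ(μ) → L^r(μ) is of class C^{⌈λ/r⌉−1} (Fréchet), and for every 1 ≤ i ≤ ⌈λ/r⌉−1 its i-th Fréchet derivative at ã ∈ L^λ(μ) is the continuous i-linear map given by D^iΞ^r_{α,ã}(ũ₁,…,ũ_i)(x) = ξ_α^{(i)}(ã(x)) ũ₁(x)⋯ũ_i(x). -/

import Mathlib

open MeasureTheory Real Set

section Holder

variable {X : Type*} [MeasurableSpace X] {μ : Measure X} [IsProbabilityMeasure μ]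

/-- Hölder's inequality on a probability space for a product of `i` functions and one real power,
when the total exponent does not exceed `lam / r`. -/
theorem lintegral_rpow_mul_prod_rpow_le {lam r s : ℝ} (hlam : 0 < lam) (hr : 0 < r) (hs : 0 ≤ s)
    {i : ℕ} (hsi : (i + s) * r ≤ lam) {h : X → ENNReal} {u : Fin i → X → ENNReal}
    (hh : AEMeasurable h μ) (hu : ∀ k, AEMeasurable (u k) μ) :
    ∫⁻ x, (h x ^ s * ∏ k, u k x) ^ r ∂μ ≤
      (∫⁻ x, h x ^ lam ∂μ) ^ (s * r / lam) * ∏ k, (∫⁻ x, u k x ^ lam ∂μ) ^ (r / lam) := by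
  have key := ENNReal.lintegral_mul_prod_norm_pow_le (μ := μ) (Finset.univ : Finset (Option (Fin i)))
    (g := fun _ => 1)
    (f := fun k x => (k.elim (h x) (fun k => u k x)) ^ lam) aemeasurable_const
    (by
      rintro (_ | k) -
      · exact hh.pow_const _
      · exact (hu k).pow_const _)
    (1 - (i + s) * r / lam) (p := fun k => k.elim (s * r / lam) (fun _ => r / lam))
    (by simp [Fintype.sum_option]; field_simp; ring)
    (by rw [sub_nonneg, div_le_one hlam]; exact hsi)
    (by rintro (_ | k) - <;> simp only [Option.elim] <;> positivity)
  simp only [Fintype.prod_option, Option.elim, ENNReal.one_rpow, one_mul, lintegral_one,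
    measure_univ, ← ENNReal.rpow_mul] at key
  refine le_trans (le_of_eq (lintegral_congr fun x => ?_)) key
  rw [ENNReal.mul_rpow_of_nonneg _ _ hr.le, ← ENNReal.prod_rpow_of_nonneg hr.le,
    ← ENNReal.rpow_mul]
  congr 1
  · congr 1; field_simp
  · refine Finset.prod_congr rfl fun k _ => ?_
    congr 1; field_simp

theorem eLpNorm_le_of_ae_le_rpow_mul_prod {lam r s C : ℝ} (hlam : 0 < lam) (hr : 0 < r)
    (hs : 0 ≤ s) (hC : 0 ≤ C) {i : ℕ} (hsi : (i + s) * r ≤ lam) {G h : X → ℝ} {u : Fin i → X → ℝ}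
    (hh : AEMeasurable h μ) (hu : ∀ k, AEMeasurable (u k) μ)
    (hG : ∀ᵐ x ∂μ, |G x| ≤ C * (|h x| ^ s * ∏ k, |u k x|)) :
    eLpNorm G (ENNReal.ofReal r) μ ≤ ENNReal.ofReal C *
      (eLpNorm h (ENNReal.ofReal lam) μ ^ s * ∏ k, eLpNorm (u k) (ENNReal.ofReal lam) μ) := by
  have hG' : ∀ᵐ x ∂μ, ‖G x‖ₑ ^ r ≤
      ENNReal.ofReal C ^ r * (‖h x‖ₑ ^ s * ∏ k, ‖u k x‖ₑ) ^ r := by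
    filter_upwards [hG] with x hx
    rw [← ENNReal.mul_rpow_of_nonneg _ _ hr.le]
    refine ENNReal.rpow_le_rpow ?_ hr.le
    simp only [Real.enorm_eq_ofReal_abs]
    rw [ENNReal.ofReal_rpow_of_nonneg (abs_nonneg _) hs,
      ← ENNReal.ofReal_prod_of_nonneg (fun _ _ => abs_nonneg _),
      ← ENNReal.ofReal_mul (by positivity), ← ENNReal.ofReal_mul hC]
    exact ENNReal.ofReal_le_ofReal hx
  have hp : ∀ {p : ℝ}, 0 < p → ∀ f : X → ℝ, eLpNorm f (ENNReal.ofReal p) μ =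
      (∫⁻ x, ‖f x‖ₑ ^ p ∂μ) ^ (1 / p) := by
    intro p hp f
    rw [eLpNorm_eq_lintegral_rpow_enorm_toReal (by simpa using hp) ENNReal.ofReal_ne_top,
      ENNReal.toReal_ofReal hp.le]
  rw [hp hr, hp hlam]
  simp only [hp hlam]
  have h1 := (lintegral_mono_ae hG').trans_eq
    (lintegral_const_mul' _ _ (ENNReal.rpow_ne_top_of_nonneg hr.le ENNReal.ofReal_ne_top))
  have h2 := h1.trans (mul_le_mul_right (lintegral_rpow_mul_prod_rpow_le hlam hr hs hsi
    hh.enorm (fun k => (hu k).enorm)) _)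
  refine (ENNReal.rpow_le_rpow h2 (by positivity : (0 : ℝ) ≤ 1 / r)).trans_eq ?_
  rw [ENNReal.mul_rpow_of_nonneg _ _ (by positivity), ENNReal.mul_rpow_of_nonneg _ _ (by positivity),
    ← ENNReal.prod_rpow_of_nonneg (by positivity)]
  simp only [← ENNReal.rpow_mul]
  rw [mul_one_div_cancel hr.ne', ENNReal.rpow_one]
  congr 2
  · congr 1; field_simp
  · refine Finset.prod_congr rfl fun k _ => ?_
    congr 1; field_simp

variable {lam r : ℝ}

theorem memLp_of_ae_le_rpow_mul_prod {s C : ℝ} (hlam : 0 < lam) (hr : 0 < r)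
    (hs : 0 ≤ s) (hC : 0 ≤ C) {i : ℕ} (hsi : (i + s) * r ≤ lam) {G h : X → ℝ} {u : Fin i → X → ℝ}
    (hh : MemLp h (ENNReal.ofReal lam) μ) (hu : ∀ k, MemLp (u k) (ENNReal.ofReal lam) μ)
    (hGm : AEStronglyMeasurable G μ)
    (hG : ∀ᵐ x ∂μ, |G x| ≤ C * (|h x| ^ s * ∏ k, |u k x|)) :
    MemLp G (ENNReal.ofReal r) μ := by
  refine ⟨hGm, (eLpNorm_le_of_ae_le_rpow_mul_prod hlam hr hs hC hsi
    hh.1.aemeasurable (fun k => (hu k).1.aemeasurable) hG).trans_lt ?_⟩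
  refine ENNReal.mul_lt_top ENNReal.ofReal_lt_top (ENNReal.mul_lt_top ?_ ?_)
  · exact ENNReal.rpow_lt_top_of_nonneg hs hh.2.ne
  · exact ENNReal.prod_lt_top fun k _ => (hu k).2

theorem Lp_norm_le_of_ae_le_rpow_mul_prod {s C : ℝ} (hlam : 0 < lam) (hr : 0 < r)
    (hs : 0 ≤ s) (hC : 0 ≤ C) {i : ℕ} (hsi : (i + s) * r ≤ lam)
    {G : Lp ℝ (ENNReal.ofReal r) μ} {h : Lp ℝ (ENNReal.ofReal lam) μ}
    {u : Fin i → Lp ℝ (ENNReal.ofReal lam) μ}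
    (hG : ∀ᵐ x ∂μ, |G x| ≤ C * (|h x| ^ s * ∏ k, |u k x|)) :
    ‖G‖ ≤ C * ‖h‖ ^ s * ∏ k, ‖u k‖ := by
  have := eLpNorm_le_of_ae_le_rpow_mul_prod hlam hr hs hC hsi
    (Lp.aestronglyMeasurable h).aemeasurable
    (fun k => (Lp.aestronglyMeasurable (u k)).aemeasurable) hG
  have hfin : ENNReal.ofReal C * (eLpNorm h (ENNReal.ofReal lam) μ ^ s *
      ∏ k, eLpNorm (u k) (ENNReal.ofReal lam) μ) ≠ ⊤ :=
    ENNReal.mul_ne_top ENNReal.ofReal_ne_top (ENNReal.mul_ne_top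
      (ENNReal.rpow_ne_top_of_nonneg hs (Lp.eLpNorm_ne_top h))
      (ENNReal.prod_ne_top fun k _ => Lp.eLpNorm_ne_top (u k)))
  have h2 := ENNReal.toReal_mono hfin this
  rw [ENNReal.toReal_mul, ENNReal.toReal_mul, ENNReal.toReal_prod, ← ENNReal.toReal_rpow,
    ENNReal.toReal_ofReal hC, ← mul_assoc] at h2
  simpa only [Lp.norm_def] using h2

end Holder

section Scalar

theorem abs_sub_le_of_abs_deriv_le {g : ℝ → ℝ} (hg : Differentiable ℝ g) {C : ℝ}
    (hC : ∀ z, |deriv g z| ≤ C) (x y : ℝ) : |g y - g x| ≤ C * |y - x| :=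
  Convex.norm_image_sub_le_of_norm_deriv_le (s := univ) (fun z _ => hg z) (fun z _ => hC z)
    convex_univ (mem_univ x) (mem_univ y)

/-- A bounded Lipschitz function is Hölder continuous of every exponent in `[0, 1]`. -/
theorem abs_sub_le_rpow_of_abs_le {g : ℝ → ℝ} (hg : Differentiable ℝ g) {M C θ : ℝ}
    (hM : ∀ z, |g z| ≤ M) (hC : ∀ z, |deriv g z| ≤ C) (hθ0 : 0 ≤ θ) (hθ1 : θ ≤ 1) (x y : ℝ) :
    |g y - g x| ≤ (2 * M + C) * |y - x| ^ θ := by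
  have hM0 : 0 ≤ M := (abs_nonneg _).trans (hM 0)
  have hC0 : 0 ≤ C := (abs_nonneg _).trans (hC 0)
  rcases le_total |y - x| 1 with h | h
  · have h1 : |y - x| ≤ |y - x| ^ θ := by
      rcases (abs_nonneg (y - x)).eq_or_lt with h0 | h0
      · rw [← h0]; exact Real.rpow_nonneg le_rfl _
      · simpa using Real.rpow_le_rpow_of_exponent_ge h0 h hθ1
    refine (abs_sub_le_of_abs_deriv_le hg hC x y).trans ?_
    exact mul_le_mul (by linarith) h1 (abs_nonneg _) (by positivity)
  · have h1 : 1 ≤ |y - x| ^ θ := Real.one_le_rpow h hθ0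
    have h2 : |g y - g x| ≤ 2 * M := by
      linarith [abs_sub (g y) (g x), hM x, hM y]
    calc |g y - g x| ≤ (2 * M + C) * 1 := by linarith
      _ ≤ _ := by gcongr

/-- Taylor remainder of first order for a function whose derivative is bounded and Lipschitz. -/
theorem abs_sub_sub_deriv_mul_le_rpow {g : ℝ → ℝ} (hg : Differentiable ℝ g)
    (hg' : Differentiable ℝ (deriv g)) {M C θ : ℝ} (hM : ∀ z, |deriv g z| ≤ M)
    (hC : ∀ z, |deriv (deriv g) z| ≤ C) (hθ0 : 0 ≤ θ) (hθ1 : θ ≤ 1) (x y : ℝ) :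
    |g y - g x - deriv g x * (y - x)| ≤ (2 * M + C) * |y - x| ^ (1 + θ) := by
  have hM0 : 0 ≤ M := (abs_nonneg _).trans (hM 0)
  have hC0 : 0 ≤ C := (abs_nonneg _).trans (hC 0)
  have key := Convex.norm_image_sub_le_of_norm_hasDerivWithin_le (s := uIcc x y)
    (f := fun t => g t - deriv g x * t) (f' := fun t => deriv g t - deriv g x)
    (C := (2 * M + C) * |y - x| ^ θ) (x := x) (y := y)
    (fun t _ => (((hg t).hasDerivAt.sub
      (((hasDerivAt_id t).const_mul (deriv g x)).congr_deriv (mul_one _)))).hasDerivWithinAt)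
    (fun t ht => (abs_sub_le_rpow_of_abs_le hg' hM hC hθ0 hθ1 x t).trans (by
      exact mul_le_mul_of_nonneg_left (Real.rpow_le_rpow (abs_nonneg _)
        (abs_sub_left_of_mem_uIcc ht) hθ0) (by positivity))) (convex_uIcc x y) left_mem_uIcc right_mem_uIcc
  rcases eq_or_ne y x with rfl | hne
  · simp only [sub_self, mul_zero, abs_zero]
    positivity
  · rw [add_comm 1 θ, Real.rpow_add_one (abs_ne_zero.mpr (sub_ne_zero.mpr hne)), ← mul_assoc]
    simp only [Real.norm_eq_abs] at key
    convert key using 2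
    ring

end Scalar

section Superposition

variable {X : Type*} [MeasurableSpace X] {μ : Measure X} {lam r : ℝ}
  [Fact (1 ≤ ENNReal.ofReal lam)] [Fact (1 ≤ ENNReal.ofReal r)]

/-- Multiplication of `i` functions in `L^lam` by `g` yields a continuous multilinear map into
`L^r`. -/
theorem exists_continuousMultilinearMap_Lp_eq_mul_prod {i : ℕ} {g : X → ℝ} {C : ℝ}
    (hg : ∀ u : Fin i → Lp ℝ (ENNReal.ofReal lam) μ,
      MemLp (fun x => g x * ∏ k, u k x) (ENNReal.ofReal r) μ)
    (hC : ∀ (u : Fin i → Lp ℝ (ENNReal.ofReal lam) μ) (G : Lp ℝ (ENNReal.ofReal r) μ),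
      (G =ᵐ[μ] fun x => g x * ∏ k, u k x) → ‖G‖ ≤ C * ∏ k, ‖u k‖) :
    ∃ T : ContinuousMultilinearMap ℝ (fun _ : Fin i => Lp ℝ (ENNReal.ofReal lam) μ)
      (Lp ℝ (ENNReal.ofReal r) μ), ∀ u, T u =ᵐ[μ] fun x => g x * ∏ k, u k x := by
  have hupd : ∀ (d : DecidableEq (Fin i)) (u : Fin i → Lp ℝ (ENNReal.ofReal lam) μ) (k : Fin i)
      (v : Lp ℝ (ENNReal.ofReal lam) μ) (x : X),
      ∏ j, (Function.update u k v j : X → ℝ) x = v x * ∏ j ∈ Finset.univ.erase k, u j x := by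
    intro d u k v x
    rw [← Finset.mul_prod_erase _ _ (Finset.mem_univ k), Function.update_self]
    congr 1
    · refine Finset.prod_congr (by congr) fun j hj => ?_
      rw [Function.update_of_ne (Finset.ne_of_mem_erase hj)]
  refine ⟨MultilinearMap.mkContinuous
    { toFun := fun u => (hg u).toLp _
      map_update_add' := fun {d} u k v w => ?_
      map_update_smul' := fun {d} u k c v => ?_ } C fun u => ?_, fun u => (hg u).coeFn_toLp⟩
  · rw [← MemLp.toLp_add, MemLp.toLp_eq_toLp_iff]
    filter_upwards [Lp.coeFn_add v w] with x hx
    simp only [hupd, hx, Pi.add_apply]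
    ring
  · rw [← MemLp.toLp_const_smul, MemLp.toLp_eq_toLp_iff]
    filter_upwards [Lp.coeFn_smul c v] with x hx
    simp only [hupd, hx, Pi.smul_apply, smul_eq_mul]
    ring
  · exact hC u _ (hg u).coeFn_toLp

variable [IsProbabilityMeasure μ] {f : ℝ → ℝ}

theorem exists_continuousMultilinearMap_superposition (hlam : 0 < lam) (hr : 0 < r)
    (hrlam : r ≤ lam) (hf : ∀ i, Differentiable ℝ (iteratedDeriv i f))
    (hbd : ∀ i, ∃ C, ∀ z, |iteratedDeriv (i + 1) f z| ≤ C) {i : ℕ} (hi : i * r ≤ lam)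
    (a : Lp ℝ (ENNReal.ofReal lam) μ) :
    ∃ T : ContinuousMultilinearMap ℝ (fun _ : Fin i => Lp ℝ (ENNReal.ofReal lam) μ)
      (Lp ℝ (ENNReal.ofReal r) μ),
      ∀ u, T u =ᵐ[μ] fun x => iteratedDeriv i f (a x) * ∏ k, u k x := by
  have hmeas : ∀ u : Fin i → Lp ℝ (ENNReal.ofReal lam) μ,
      AEStronglyMeasurable (fun x => iteratedDeriv i f (a x) * ∏ k, u k x) μ := fun u =>
    ((hf i).continuous.comp_aestronglyMeasurable (Lp.aestronglyMeasurable a)).mul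
      (Finset.aestronglyMeasurable_fun_prod _ fun k _ => Lp.aestronglyMeasurable (u k))
  cases i with
  | zero =>
    obtain ⟨C, hC⟩ := hbd 0
    have hC0 : 0 ≤ C := (abs_nonneg _).trans (hC 0)
    rw [zero_add, iteratedDeriv_one] at hC
    have hle : ENNReal.ofReal r ≤ ENNReal.ofReal lam := ENNReal.ofReal_le_ofReal hrlam
    have hmem : MemLp (fun x => f (a x)) (ENNReal.ofReal r) μ := by
      have hg : MemLp (fun x => |f 0| + C * |a x|) (ENNReal.ofReal r) μ :=
        (memLp_const |f 0|).add ((((Lp.memLp a).mono_exponent hle).norm).const_mul C)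
      refine hg.of_le (by simpa using hmeas default) (Filter.Eventually.of_forall fun x => ?_)
      have h1 := abs_sub_le_of_abs_deriv_le (by simpa using hf 0) hC 0 (a x)
      have h2 := abs_sub_abs_le_abs_sub (f (a x)) (f 0)
      rw [sub_zero] at h1
      rw [Real.norm_eq_abs, Real.norm_eq_abs]
      exact (by linarith : |f (a x)| ≤ |f 0| + C * |a x|).trans (le_abs_self _)
    refine exists_continuousMultilinearMap_Lp_eq_mul_prod (C := ‖hmem.toLp _‖)
      (fun u => by simpa using hmem) fun u G hG => ?_
    have : G = hmem.toLp _ := Lp.ext (hG.trans (by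
      filter_upwards [hmem.coeFn_toLp] with x hx
      simp [hx]))
    simp [this]
  | succ i =>
    obtain ⟨C, hC⟩ := hbd i
    have hC0 : 0 ≤ C := (abs_nonneg _).trans (hC 0)
    have hsi : (((i + 1 : ℕ) : ℝ) + 0) * r ≤ lam := by rwa [add_zero]
    have hle : ∀ (u : Fin (i + 1) → Lp ℝ (ENNReal.ofReal lam) μ) (x : X),
        |iteratedDeriv (i + 1) f (a x) * ∏ k, u k x| ≤
          C * (|a x| ^ (0 : ℝ) * ∏ k, |u k x|) := fun u x => by
      rw [abs_mul, Finset.abs_prod, Real.rpow_zero, one_mul]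
      exact mul_le_mul_of_nonneg_right (hC _) (by positivity)
    refine exists_continuousMultilinearMap_Lp_eq_mul_prod (C := C) (fun u => ?_) fun u G hG => ?_
    · exact memLp_of_ae_le_rpow_mul_prod hlam hr le_rfl hC0 hsi (Lp.memLp a)
        (fun k => Lp.memLp (u k)) (hmeas u) (Filter.Eventually.of_forall (hle u))
    · have := Lp_norm_le_of_ae_le_rpow_mul_prod (G := G) (h := a) (u := u) hlam hr le_rfl hC0 hsi
        (hG.mono fun x hx => by rw [hx]; exact hle u x)
      simpa using this

/-- A superposition operator from `L^lam` to `L^r` whose symbol has bounded derivatives of all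
positive orders has a Taylor series, given by pointwise multiplication with derivatives of the
symbol, up to every order `N < lam / r`. -/
theorem exists_hasFTaylorSeriesUpTo_superposition (hr : 0 < r)
    (hrlam : r ≤ lam) (hf : ∀ i, Differentiable ℝ (iteratedDeriv i f))
    (hbd : ∀ i, ∃ C, ∀ z, |iteratedDeriv (i + 1) f z| ≤ C) {N : ℕ} (hN : N * r < lam) :
    ∃ (F : Lp ℝ (ENNReal.ofReal lam) μ → Lp ℝ (ENNReal.ofReal r) μ)
      (p : Lp ℝ (ENNReal.ofReal lam) μ → FormalMultilinearSeries ℝ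
        (Lp ℝ (ENNReal.ofReal lam) μ) (Lp ℝ (ENNReal.ofReal r) μ)),
      HasFTaylorSeriesUpTo N F p ∧ (∀ a, F a =ᵐ[μ] fun x => f (a x)) ∧
      ∀ i ≤ N, ∀ a u, p a i u =ᵐ[μ] fun x => iteratedDeriv i f (a x) * ∏ k, u k x := by
  have hlam : 0 < lam := hr.trans_le hrlam
  have hex : ∀ (a : Lp ℝ (ENNReal.ofReal lam) μ) (i : ℕ),
      ∃ T : ContinuousMultilinearMap ℝ (fun _ : Fin i => Lp ℝ (ENNReal.ofReal lam) μ)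
        (Lp ℝ (ENNReal.ofReal r) μ), i ≤ N →
        ∀ u, T u =ᵐ[μ] fun x => iteratedDeriv i f (a x) * ∏ k, u k x := by
    intro a i
    by_cases hi : i ≤ N
    · have hi' : i * r ≤ lam := le_trans (by gcongr) hN.le
      obtain ⟨T, hT⟩ := exists_continuousMultilinearMap_superposition hlam hr hrlam hf hbd hi' a
      exact ⟨T, fun _ => hT⟩
    · exact ⟨0, fun h => absurd h hi⟩
  choose p hp using hex
  obtain ⟨θ, hθ0, hθ1, hNθ⟩ : ∃ θ : ℝ, 0 < θ ∧ θ ≤ 1 ∧ (N + θ) * r ≤ lam := by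
    refine ⟨min 1 (lam / r - N), lt_min one_pos (sub_pos.mpr ((lt_div_iff₀ hr).mpr hN)),
      min_le_left _ _, ?_⟩
    rw [← le_div_iff₀ hr]
    linarith [min_le_right 1 (lam / r - N)]
  refine ⟨fun a => (p a 0).curry0, p, ⟨fun _ => rfl, fun m hm a => ?_, fun m hm => ?_⟩,
    fun a => ?_, fun i hi a u => hp a i hi u⟩
  · have hm' : m + 1 ≤ N := by exact_mod_cast hm
    obtain ⟨M, hM⟩ := hbd m
    obtain ⟨C, hC⟩ := hbd (m + 1)
    have hM0 : 0 ≤ M := (abs_nonneg _).trans (hM 0)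
    have hC0 : 0 ≤ C := (abs_nonneg _).trans (hC 0)
    have hd := hf (m + 1)
    rw [iteratedDeriv_succ] at hd hM
    rw [iteratedDeriv_succ, iteratedDeriv_succ] at hC
    have hsi : ((m : ℝ) + (1 + θ)) * r ≤ lam := by
      refine le_trans ?_ hNθ
      have : (m : ℝ) + 1 ≤ N := by exact_mod_cast hm'
      exact mul_le_mul_of_nonneg_right (by linarith) hr.le
    have hbound : ∀ b, ‖p b m - p a m - (p a m.succ).curryLeft (b - a)‖ ≤
        (2 * M + C) * ‖b - a‖ ^ (1 + θ) := by
      intro b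
      refine ContinuousMultilinearMap.opNorm_le_bound (by positivity) fun u => ?_
      refine Lp_norm_le_of_ae_le_rpow_mul_prod hlam hr (by positivity) (by positivity) hsi ?_
      simp only [_root_.sub_apply, ContinuousMultilinearMap.curryLeft_apply]
      filter_upwards [Lp.coeFn_sub (p b m u - p a m u) (p a m.succ (Fin.cons (b - a) u)),
        Lp.coeFn_sub (p b m u) (p a m u), hp b m (by omega) u, hp a m (by omega) u,
        hp a m.succ hm' (Fin.cons (b - a) u), Lp.coeFn_sub b a] with x h1 h2 h3 h4 h5 h6
      rw [h1, Pi.sub_apply, h2, Pi.sub_apply, h3, h4, h5, h6, Pi.sub_apply, Fin.prod_univ_succ]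
      simp only [Fin.cons_zero, Fin.cons_succ, h6, Pi.sub_apply, iteratedDeriv_succ]
      rw [← mul_assoc (2 * M + C), ← Finset.abs_prod]
      refine le_trans (le_of_eq ?_) (mul_le_mul_of_nonneg_right
        (abs_sub_sub_deriv_mul_le_rpow (hf m) hd hM hC hθ0.le hθ1 (a x) (b x)) (abs_nonneg _))
      rw [← abs_mul]
      congr 1
      ring
    rw [hasFDerivAt_iff_tendsto]
    refine squeeze_zero (fun _ => by positivity) (g := fun b => (2 * M + C) * ‖b - a‖ ^ θ)
      (fun b => ?_) ?_
    · rcases (norm_nonneg (b - a)).eq_or_lt with h0 | h0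
      · rw [← h0, inv_zero, zero_mul]
        positivity
      · rw [inv_mul_le_iff₀ h0]
        refine (hbound b).trans_eq ?_
        rw [Real.rpow_add h0, Real.rpow_one]
        ring
    · have : Filter.Tendsto (fun b => (2 * M + C) * ‖b - a‖ ^ θ) (nhds a)
          (nhds ((2 * M + C) * ‖a - a‖ ^ θ)) :=
        (((continuous_id.sub continuous_const).norm.rpow_const
          fun _ => Or.inr hθ0.le).const_mul _).tendsto a
      simpa [Real.zero_rpow hθ0.ne'] using this
  · have hm' : m ≤ N := by exact_mod_cast hm
    obtain ⟨τ, K, hτ, hK, hsi, hH⟩ : ∃ τ K : ℝ, 0 < τ ∧ 0 ≤ K ∧ ((m : ℝ) + τ) * r ≤ lam ∧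
        ∀ x y, |iteratedDeriv m f y - iteratedDeriv m f x| ≤ K * |y - x| ^ τ := by
      obtain ⟨C, hC⟩ := hbd m
      have hC0 : 0 ≤ C := (abs_nonneg _).trans (hC 0)
      rw [iteratedDeriv_succ] at hC
      cases m with
      | zero =>
        refine ⟨1, C, one_pos, hC0, by simpa using hrlam, fun x y => ?_⟩
        simpa only [Real.rpow_one] using abs_sub_le_of_abs_deriv_le (hf 0) hC x y
      | succ m =>
        obtain ⟨M, hM⟩ := hbd m
        have hM0 : 0 ≤ M := (abs_nonneg _).trans (hM 0)
        refine ⟨θ, 2 * M + C, hθ0, by positivity, le_trans (by gcongr) hNθ, fun x y => ?_⟩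
        exact abs_sub_le_rpow_of_abs_le (hf (m + 1)) hM hC hθ0.le hθ1 x y
    have hbound : ∀ a b, ‖p b m - p a m‖ ≤ K * ‖b - a‖ ^ τ := by
      intro a b
      refine ContinuousMultilinearMap.opNorm_le_bound (by positivity) fun u => ?_
      refine Lp_norm_le_of_ae_le_rpow_mul_prod hlam hr hτ.le hK hsi ?_
      rw [_root_.sub_apply]
      filter_upwards [Lp.coeFn_sub (p b m u) (p a m u), hp b m hm' u, hp a m hm' u,
        Lp.coeFn_sub b a] with x h2 h3 h4 h6
      rw [h2, Pi.sub_apply, h3, h4, h6, Pi.sub_apply, ← sub_mul, abs_mul, Finset.abs_prod,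
        ← mul_assoc]
      exact mul_le_mul_of_nonneg_right (hH _ _) (by positivity)
    rw [continuous_iff_continuousAt]
    intro a
    rw [ContinuousAt, tendsto_iff_norm_sub_tendsto_zero]
    refine squeeze_zero (fun _ => norm_nonneg _) (fun b => hbound a b) ?_
    have : Filter.Tendsto (fun b => K * ‖b - a‖ ^ τ) (nhds a) (nhds (K * ‖a - a‖ ^ τ)) :=
      (((continuous_id.sub continuous_const).norm.rpow_const
        fun _ => Or.inr hτ.le).const_mul _).tendsto a
    simpa [Real.zero_rpow hτ.ne'] using this
  · refine (hp a 0 (Nat.zero_le N) 0).trans (Filter.Eventually.of_forall fun x => ?_)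
    simp

end Superposition

theorem monotone_of_add_log_eq {ψ : ℝ → ℝ} (hψ : ∀ z : ℝ, 0 < ψ z ∧ ψ z + Real.log (ψ z) = z) :
    Monotone ψ := by
  intro x y hxy
  by_contra! h
  have := Real.log_le_log (hψ y).1 h.le
  linarith [(hψ x).2, (hψ y).2]

theorem continuous_of_add_log_eq {ψ : ℝ → ℝ}
    (hψ : ∀ z : ℝ, 0 < ψ z ∧ ψ z + Real.log (ψ z) = z) : Continuous ψ := by
  refine (LipschitzWith.of_le_add (f := ψ) fun x y => ?_).continuous
  rcases le_total x y with hxy | hxy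
  · linarith [monotone_of_add_log_eq hψ hxy, dist_nonneg (x := x) (y := y)]
  · have := Real.log_le_log (hψ y).1 (monotone_of_add_log_eq hψ hxy)
    linarith [(hψ x).2, (hψ y).2, Real.dist_eq x y, le_abs_self (x - y)]

theorem hasDerivAt_of_add_log_eq {ψ : ℝ → ℝ}
    (hψ : ∀ z : ℝ, 0 < ψ z ∧ ψ z + Real.log (ψ z) = z) (z : ℝ) :
    HasDerivAt ψ (ψ z / (1 + ψ z)) z := by
  have hz := (hψ z).1
  have h := HasDerivAt.of_local_left_inverse (f := fun y => y + Real.log y) (f' := 1 + (ψ z)⁻¹)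
    (continuous_of_add_log_eq hψ).continuousAt
    ((hasDerivAt_id (ψ z)).add (Real.hasDerivAt_log hz.ne')) (by positivity)
    (Filter.Eventually.of_forall fun y => (hψ y).2)
  refine h.congr_deriv ?_
  field_simp
  ring

theorem hasDerivAt_rpow_mul_inv_mul_eval {ψ : ℝ → ℝ}
    (hψ : ∀ z : ℝ, 0 < ψ z ∧ ψ z + Real.log (ψ z) = z) (β : ℝ) (P : Polynomial ℝ) (z : ℝ) :
    HasDerivAt (fun z => ψ z ^ β * (1 + ψ z)⁻¹ * P.eval (1 + ψ z)⁻¹)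
      (ψ z ^ β * (1 + ψ z)⁻¹ *
        (P * (Polynomial.C β * Polynomial.X - Polynomial.X + Polynomial.X ^ 2) +
          P.derivative * (Polynomial.X ^ 3 - Polynomial.X ^ 2)).eval (1 + ψ z)⁻¹) z := by
  have hz := (hψ z).1
  have h0 := hasDerivAt_of_add_log_eq hψ z
  have h1 := h0.rpow_const (p := β) (Or.inl hz.ne')
  have h2 := (h0.const_add 1).inv (by positivity)
  have h3 := (P.hasDerivAt (1 + ψ z)⁻¹).comp z h2
  refine ((h1.mul h2).mul h3).congr_deriv ?_
  rw [Real.rpow_sub_one hz.ne']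
  simp only [Polynomial.eval_add, Polynomial.eval_mul, Polynomial.eval_sub, Polynomial.eval_C,
    Polynomial.eval_X, Polynomial.eval_pow, Function.comp, Pi.mul_apply, Pi.inv_apply]
  generalize Polynomial.eval (1 + ψ z)⁻¹ P = p
  generalize Polynomial.eval (1 + ψ z)⁻¹ (Polynomial.derivative P) = q
  field_simp
  ring

theorem hasDerivAt_alpha_embedding {ψ : ℝ → ℝ}
    (hψ : ∀ z : ℝ, 0 < ψ z ∧ ψ z + Real.log (ψ z) = z) {α : ℝ} {ξ : ℝ → ℝ}
    (hξ : ∀ z : ℝ, ξ z = if α = 1 then z - ψ z else (2 / (1 - α)) * ψ z ^ ((1 - α) / 2))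
    (z : ℝ) : HasDerivAt ξ (ψ z ^ ((1 - α) / 2) * (1 + ψ z)⁻¹) z := by
  have hz := (hψ z).1
  have h0 := hasDerivAt_of_add_log_eq hψ z
  rw [funext hξ]
  split_ifs with h
  · refine ((hasDerivAt_id' z).sub h0).congr_deriv ?_
    rw [h, sub_self, zero_div, Real.rpow_zero]
    field_simp
    ring
  · have h' : 1 - α ≠ 0 := sub_ne_zero.mpr (Ne.symm h)
    refine ((h0.rpow_const (p := (1 - α) / 2) (Or.inl hz.ne')).const_mul
      (2 / (1 - α))).congr_deriv ?_
    rw [Real.rpow_sub_one hz.ne']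
    field_simp

theorem exists_iteratedDeriv_alpha_embedding_eq {ψ : ℝ → ℝ}
    (hψ : ∀ z : ℝ, 0 < ψ z ∧ ψ z + Real.log (ψ z) = z) {α : ℝ} {ξ : ℝ → ℝ}
    (hξ : ∀ z : ℝ, ξ z = if α = 1 then z - ψ z else (2 / (1 - α)) * ψ z ^ ((1 - α) / 2))
    (i : ℕ) : ∃ P : Polynomial ℝ, iteratedDeriv (i + 1) ξ =
      fun z => ψ z ^ ((1 - α) / 2) * (1 + ψ z)⁻¹ * P.eval (1 + ψ z)⁻¹ := by
  induction i with
  | zero =>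
    refine ⟨1, funext fun z => ?_⟩
    simpa using (hasDerivAt_alpha_embedding hψ hξ z).deriv
  | succ i ih =>
    obtain ⟨P, hP⟩ := ih
    rw [iteratedDeriv_succ, hP]
    exact ⟨_, funext fun z => (hasDerivAt_rpow_mul_inv_mul_eval hψ _ P z).deriv⟩

theorem differentiable_iteratedDeriv_alpha_embedding {ψ : ℝ → ℝ}
    (hψ : ∀ z : ℝ, 0 < ψ z ∧ ψ z + Real.log (ψ z) = z) {α : ℝ} {ξ : ℝ → ℝ}
    (hξ : ∀ z : ℝ, ξ z = if α = 1 then z - ψ z else (2 / (1 - α)) * ψ z ^ ((1 - α) / 2))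
    (i : ℕ) : Differentiable ℝ (iteratedDeriv i ξ) := by
  cases i with
  | zero =>
    rw [iteratedDeriv_zero]
    exact fun z => (hasDerivAt_alpha_embedding hψ hξ z).differentiableAt
  | succ i =>
    obtain ⟨P, hP⟩ := exists_iteratedDeriv_alpha_embedding_eq hψ hξ i
    rw [hP]
    exact fun z => (hasDerivAt_rpow_mul_inv_mul_eval hψ _ P z).differentiableAt

theorem exists_bound_iteratedDeriv_alpha_embedding {ψ : ℝ → ℝ}
    (hψ : ∀ z : ℝ, 0 < ψ z ∧ ψ z + Real.log (ψ z) = z) {α : ℝ} (hα : α ∈ Icc (-1 : ℝ) 1)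
    {ξ : ℝ → ℝ}
    (hξ : ∀ z : ℝ, ξ z = if α = 1 then z - ψ z else (2 / (1 - α)) * ψ z ^ ((1 - α) / 2))
    (i : ℕ) : ∃ C : ℝ, ∀ z, |iteratedDeriv (i + 1) ξ z| ≤ C := by
  obtain ⟨P, hP⟩ := exists_iteratedDeriv_alpha_embedding_eq hψ hξ i
  obtain ⟨C, hC⟩ := (isCompact_Icc (a := (0 : ℝ)) (b := 1)).exists_bound_of_continuousOn
    P.continuous.continuousOn
  refine ⟨C, fun z => ?_⟩
  have hz := (hψ z).1
  have hβ0 : 0 ≤ (1 - α) / 2 := by linarith [hα.2]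
  have hβ1 : (1 - α) / 2 ≤ 1 := by linarith [hα.1]
  have hpow : ψ z ^ ((1 - α) / 2) ≤ 1 + ψ z := by
    rcases le_total (ψ z) 1 with h | h
    · linarith [Real.rpow_le_one hz.le h hβ0]
    · have := Real.rpow_le_rpow_of_exponent_le h hβ1
      rw [Real.rpow_one] at this
      linarith
  have ht : (1 + ψ z)⁻¹ ∈ Icc (0 : ℝ) 1 := ⟨by positivity, inv_le_one_of_one_le₀ (by linarith)⟩
  have hg : ψ z ^ ((1 - α) / 2) * (1 + ψ z)⁻¹ ≤ 1 := by
    rw [← div_eq_mul_inv, div_le_one (by positivity)]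
    exact hpow
  rw [hP, abs_mul, abs_of_nonneg (by positivity : 0 ≤ ψ z ^ ((1 - α) / 2) * (1 + ψ z)⁻¹)]
  exact (mul_le_of_le_one_left (abs_nonneg _) hg).trans (hC _ ht)

/-- Lemma 2.1(i): for `α ∈ [−1,1]`, `r ∈ [1,λ]`, the superposition operator
`Ξ_α^r : L^λ(μ) → L^r(μ)`, `Ξ_α^r(ã)(x) = ξ_α(ã(x))`, is of class `C^{⌈λ/r⌉−1}`, and for
`1 ≤ i ≤ ⌈λ/r⌉−1` its `i`-th Fréchet derivative is the continuous `i`-linear map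
`(ũ₁,…,ũ_i) ↦ ξ_α^{(i)}(ã)·ũ₁⋯ũ_i`. -/
theorem stmt_3 {X : Type*} [MeasurableSpace X] (μ : Measure X) [IsProbabilityMeasure μ]
    (lam r : ℝ) (hlam : 2 ≤ lam) (hr : 1 ≤ r) (hrlam : r ≤ lam)
    [Fact (1 ≤ ENNReal.ofReal lam)] [Fact (1 ≤ ENNReal.ofReal r)]
    (ψ : ℝ → ℝ) (hψ : ∀ z : ℝ, 0 < ψ z ∧ ψ z + Real.log (ψ z) = z)
    (α : ℝ) (hα : α ∈ Icc (-1 : ℝ) 1)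
    (ξ : ℝ → ℝ)
    (hξ : ∀ z : ℝ, ξ z = if α = 1 then z - ψ z else (2 / (1 - α)) * ψ z ^ ((1 - α) / 2)) :
    ∃ Ξ : Lp ℝ (ENNReal.ofReal lam) μ → Lp ℝ (ENNReal.ofReal r) μ,
      (∀ a : Lp ℝ (ENNReal.ofReal lam) μ, Ξ a =ᵐ[μ] fun x => ξ (a x)) ∧
      ContDiff ℝ ((⌈lam / r⌉ - 1).toNat) Ξ ∧
      (∀ i : ℕ, 1 ≤ i → (i : ℤ) ≤ ⌈lam / r⌉ - 1 →
        ∀ (a : Lp ℝ (ENNReal.ofReal lam) μ) (u : Fin i → Lp ℝ (ENNReal.ofReal lam) μ),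
          (iteratedFDeriv ℝ i Ξ a u : Lp ℝ (ENNReal.ofReal r) μ) =ᵐ[μ]
            fun x => iteratedDeriv i ξ (a x) * ∏ k, u k x) := by
  have hr0 : 0 < r := by linarith
  have hceil : 1 ≤ ⌈lam / r⌉ := Int.one_le_ceil_iff.mpr (by positivity)
  have hN : ((⌈lam / r⌉ - 1).toNat : ℝ) * r < lam := by
    have h1 : (((⌈lam / r⌉ - 1).toNat : ℤ)) < ⌈lam / r⌉ := by omega
    rw [Int.lt_ceil, lt_div_iff₀ hr0] at h1
    exact_mod_cast h1
  obtain ⟨F, p, hFp, hF, hp⟩ := exists_hasFTaylorSeriesUpTo_superposition (μ := μ) hr0 hrlam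
    (differentiable_iteratedDeriv_alpha_embedding hψ hξ)
    (exists_bound_iteratedDeriv_alpha_embedding hψ hα hξ) hN
  refine ⟨F, hF, HasFTaylorSeriesUpTo.contDiff (n := ((⌈lam / r⌉ - 1).toNat : ℕ)) hFp,
    fun i _ hi a u => ?_⟩
  have hiN : i ≤ (⌈lam / r⌉ - 1).toNat := by omega
  rw [← hFp.eq_iteratedFDeriv (by exact_mod_cast hiN) a]
  exact hp i hiN a u
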